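/- Let p ≥ 2 be an even integer and 0 ≤ i ≤ p−1. Let H ⊆ E be feasible for (p,3)-FGC such that for every A with ∅ ≠ A ⊊ V, if |δ_H(A)| = p+3 then |δ_{H∩𝒮}(A)| ≥ i. Then the family 𝒞_i = {A ⊆ V : ∅ ≠ A ⊊ V, |δ_H(A)| = p+3 and |δ_{H∩𝒮}(A)| = i} is uncrossable. -/

import Mathlib

open scoped BigOperators

/-- An edge `e` crosses the vertex set `A` if exactly one of its endpoints lies in `A`. -/
def crosses {V E : Type*} (ends : E → Sym2 V) (A : Set V) (e : E) : Prop :=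
  ∃ u v : V, ends e = s(u, v) ∧ u ∈ A ∧ v ∉ A

/-- `cut ends F A` is `δ_F(A)`: the set of edges of `F` with exactly one endpoint in `A`. -/
def cut {V E : Type*} (ends : E → Sym2 V) (F : Set E) (A : Set V) : Set E :=
  {e | e ∈ F ∧ crosses ends A e}

/-- Two vertex sets properly intersect. -/
def properlyIntersect {V : Type*} (A B : Set V) : Prop :=
  (A ∩ B).Nonempty ∧ (A \ B).Nonempty ∧ (B \ A).Nonempty

/-- `F` is feasible for `(p,q)`-FGC. -/
def fgcFeasible {V E : Type*} (ends : E → Sym2 V) (𝒮 : Set E) (p q : ℕ) (F : Set E) : Prop :=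
  ∀ A : Set V, A.Nonempty → A ≠ Set.univ →
    p ≤ (cut ends (F ∩ 𝒮) A).ncard ∨ p + q ≤ (cut ends F A).ncard

/-- Two properly intersecting members of the family `𝒞` uncross. -/
def uncross {V : Type*} (𝒞 : Set (Set V)) (A B : Set V) : Prop :=
  (A ∩ B ∈ 𝒞 ∧ A ∪ B ∈ 𝒞) ∨ (A \ B ∈ 𝒞 ∧ B \ A ∈ 𝒞)

/-- The family `𝒞` is uncrossable. -/
def uncrossable {V : Type*} (𝒞 : Set (Set V)) : Prop :=
  ∀ A B, A ∈ 𝒞 → B ∈ 𝒞 → properlyIntersect A B → uncross 𝒞 A B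

/-- The edges of `F` with one endpoint in `X` and the other in `Y`. -/
def edgesBetween {V E : Type*} (ends : E → Sym2 V) (F : Set E) (X Y : Set V) : Set E :=
  {e | e ∈ F ∧ ∃ u v : V, ends e = s(u, v) ∧ u ∈ X ∧ v ∈ Y}

theorem edgesBetween_comm {V E : Type*} (ends : E → Sym2 V) (F : Set E) (X Y : Set V) :
    edgesBetween ends F X Y = edgesBetween ends F Y X := by
  ext e
  constructor <;> rintro ⟨he, u, v, h, hu, hv⟩ <;>
    exact ⟨he, v, u, h.trans Sym2.eq_swap, hv, hu⟩

theorem cut_eq_edgesBetween {V E : Type*} (ends : E → Sym2 V) (F : Set E) {X Y : Set V}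
    (h : Xᶜ = Y) : cut ends F X = edgesBetween ends F X Y := by
  subst h
  rfl

theorem ncard_edgesBetween_union_right {V E : Type*} [Finite E] (ends : E → Sym2 V) (F : Set E)
    {X Y Z : Set V} (hXY : Disjoint X Y) (hYZ : Disjoint Y Z) :
    (edgesBetween ends F X (Y ∪ Z)).ncard =
      (edgesBetween ends F X Y).ncard + (edgesBetween ends F X Z).ncard := by
  rw [← Set.ncard_union_eq]
  · congr 1
    ext e
    simp only [edgesBetween, Set.mem_union, Set.mem_ofPred_eq]
    grind
  · rw [Set.disjoint_left] at hXY hYZ ⊢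
    rintro e ⟨-, u, v, h, hu, hv⟩ ⟨-, u', v', h', hu', hv'⟩
    rw [h, Sym2.eq_iff] at h'
    rcases h' with ⟨rfl, rfl⟩ | ⟨rfl, rfl⟩
    · exact hYZ hv hv'
    · exact hXY hu' hv

theorem ncard_edgesBetween_union_left {V E : Type*} [Finite E] (ends : E → Sym2 V) (F : Set E)
    {X Y Z : Set V} (hXZ : Disjoint X Z) (hXY : Disjoint X Y) :
    (edgesBetween ends F (X ∪ Y) Z).ncard =
      (edgesBetween ends F X Z).ncard + (edgesBetween ends F Y Z).ncard := by
  rw [edgesBetween_comm, ncard_edgesBetween_union_right ends F hXZ.symm hXY,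
    edgesBetween_comm ends F Z X, edgesBetween_comm ends F Z Y]

/-- The cuts of two sets and of the four regions they determine, in terms of the numbers of edges
between pairs of regions `a = A ∩ B`, `b = A \ B`, `c = B \ A`, `d = (A ∪ B)ᶜ`. -/
theorem exists_ncard_cut_eq {V E : Type*} [Finite E] (ends : E → Sym2 V) (A B : Set V) :
    ∃ a b c d : Set V, ∀ F : Set E,
      (cut ends F A).ncard =
        (edgesBetween ends F a c).ncard + (edgesBetween ends F a d).ncard +
          ((edgesBetween ends F b c).ncard + (edgesBetween ends F b d).ncard) ∧
      (cut ends F B).ncard =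
        (edgesBetween ends F a b).ncard + (edgesBetween ends F a d).ncard +
          ((edgesBetween ends F b c).ncard + (edgesBetween ends F c d).ncard) ∧
      (cut ends F (A ∩ B)).ncard =
        (edgesBetween ends F a b).ncard +
          ((edgesBetween ends F a c).ncard + (edgesBetween ends F a d).ncard) ∧
      (cut ends F (A \ B)).ncard =
        (edgesBetween ends F a b).ncard +
          ((edgesBetween ends F b c).ncard + (edgesBetween ends F b d).ncard) ∧
      (cut ends F (B \ A)).ncard =
        (edgesBetween ends F a c).ncard +
          ((edgesBetween ends F b c).ncard + (edgesBetween ends F c d).ncard) ∧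
      (cut ends F (A ∪ B)).ncard =
        (edgesBetween ends F a d).ncard +
          ((edgesBetween ends F b d).ncard + (edgesBetween ends F c d).ncard) := by
  have hA : A = A ∩ B ∪ A \ B := (Set.inter_union_sdiff A B).symm
  have hB : B = A ∩ B ∪ B \ A := by grind
  have hU : A ∪ B = A ∩ B ∪ (A \ B ∪ B \ A) := by grind
  obtain ⟨a, ha⟩ : ∃ a, a = A ∩ B := ⟨_, rfl⟩
  obtain ⟨b, hb⟩ : ∃ b, b = A \ B := ⟨_, rfl⟩
  obtain ⟨c, hc⟩ : ∃ c, c = B \ A := ⟨_, rfl⟩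
  obtain ⟨d, hd⟩ : ∃ d, d = (A ∪ B)ᶜ := ⟨_, rfl⟩
  have dab : Disjoint a b := by rw [Set.disjoint_left]; grind
  have dac : Disjoint a c := by rw [Set.disjoint_left]; grind
  have dad : Disjoint a d := by rw [Set.disjoint_left]; grind
  have dbc : Disjoint b c := by rw [Set.disjoint_left]; grind
  have dbd : Disjoint b d := by rw [Set.disjoint_left]; grind
  have dcd : Disjoint c d := by rw [Set.disjoint_left]; grind
  have cA : (a ∪ b)ᶜ = c ∪ d := by ext; grind
  have cB : (a ∪ c)ᶜ = b ∪ d := by ext; grind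
  have ca : aᶜ = b ∪ (c ∪ d) := by ext; grind
  have cb : bᶜ = a ∪ (c ∪ d) := by ext; grind
  have cc : cᶜ = a ∪ (b ∪ d) := by ext; grind
  have cU : (a ∪ (b ∪ c))ᶜ = d := by ext; grind
  refine ⟨a, b, c, d, fun F => ⟨?_, ?_, ?_, ?_, ?_, ?_⟩⟩
  · rw [hA, ← ha, ← hb, cut_eq_edgesBetween ends F cA,
      ncard_edgesBetween_union_left ends F (dac.union_right dad) dab,
      ncard_edgesBetween_union_right ends F dac dcd, ncard_edgesBetween_union_right ends F dbc dcd]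
  · rw [hB, ← ha, ← hc, cut_eq_edgesBetween ends F cB,
      ncard_edgesBetween_union_left ends F (dab.union_right dad) dac,
      ncard_edgesBetween_union_right ends F dab dbd,
      ncard_edgesBetween_union_right ends F dbc.symm dbd, edgesBetween_comm ends F c b]
  · rw [← ha, cut_eq_edgesBetween ends F ca,
      ncard_edgesBetween_union_right ends F dab (dbc.union_right dbd),
      ncard_edgesBetween_union_right ends F dac dcd]
  · rw [← hb, cut_eq_edgesBetween ends F cb,
      ncard_edgesBetween_union_right ends F dab.symm (dac.union_right dad),
      ncard_edgesBetween_union_right ends F dbc dcd, edgesBetween_comm ends F b a]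
  · rw [← hc, cut_eq_edgesBetween ends F cc,
      ncard_edgesBetween_union_right ends F dac.symm (dab.union_right dad),
      ncard_edgesBetween_union_right ends F dbc.symm dbd, edgesBetween_comm ends F c a,
      edgesBetween_comm ends F c b]
  · rw [hU, ← ha, ← hb, ← hc, cut_eq_edgesBetween ends F cU,
      ncard_edgesBetween_union_left ends F dad (dab.union_right dac),
      ncard_edgesBetween_union_left ends F dbd dbc]

theorem cut_compl {V E : Type*} (ends : E → Sym2 V) (F : Set E) (A : Set V) :
    cut ends F Aᶜ = cut ends F A := by
  rw [cut_eq_edgesBetween ends F (compl_compl A), edgesBetween_comm,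
    ← cut_eq_edgesBetween ends F rfl]

theorem stmt10 {V E : Type*} [Fintype V] [Fintype E]
    (ends : E → Sym2 V) (𝒮 𝒰 : Set E)
    (hpart : 𝒮 ∪ 𝒰 = Set.univ) (hdisj : Disjoint 𝒮 𝒰)
    (p i : ℕ) (hp : 2 ≤ p) (hpeven : Even p) (hi : i ≤ p - 1)
    (H : Set E) (hfeas : fgcFeasible ends 𝒮 p 3 H)
    (hH : ∀ A : Set V, A.Nonempty → A ≠ Set.univ →
      (cut ends H A).ncard = p + 3 → i ≤ (cut ends (H ∩ 𝒮) A).ncard) :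
    uncrossable {A : Set V | A.Nonempty ∧ A ≠ Set.univ ∧
      (cut ends H A).ncard = p + 3 ∧ (cut ends (H ∩ 𝒮) A).ncard = i} := by
  rintro A B ⟨-, hAu, hAd, hAs⟩ ⟨-, hBu, hBd, hBs⟩ ⟨hI, hAB, hBA⟩
  have hIu : A ∩ B ≠ Set.univ := fun h => hAu (Set.univ_subset_iff.1 (h ▸ Set.inter_subset_left))
  have hABu : A \ B ≠ Set.univ := fun h => hAu (Set.univ_subset_iff.1 (h ▸ Set.sdiff_subset))
  have hBAu : B \ A ≠ Set.univ := fun h => hBu (Set.univ_subset_iff.1 (h ▸ Set.sdiff_subset))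
  by_cases hUu : A ∪ B = Set.univ
  · have h₁ : A \ B = Bᶜ := by ext x; have := Set.mem_univ x; grind
    have h₂ : B \ A = Aᶜ := by ext x; have := Set.mem_univ x; grind
    refine Or.inr ⟨⟨hAB, hABu, ?_⟩, ⟨hBA, hBAu, ?_⟩⟩
    · rw [h₁, cut_compl, cut_compl]
      exact ⟨hBd, hBs⟩
    · rw [h₂, cut_compl, cut_compl]
      exact ⟨hAd, hAs⟩
  have hU : (A ∪ B).Nonempty := hI.mono fun _ hx => Or.inl hx.1
  have fI := hfeas _ hI hIu
  have fU := hfeas _ hU hUu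
  have fAB := hfeas _ hAB hABu
  have fBA := hfeas _ hBA hBAu
  have gI := hH _ hI hIu
  have gU := hH _ hU hUu
  have gAB := hH _ hAB hABu
  have gBA := hH _ hBA hBAu
  obtain ⟨a, b, c, d, h⟩ := exists_ncard_cut_eq ends A B
  obtain ⟨h₁, h₂, h₃, h₄, h₅, h₆⟩ := h H
  obtain ⟨k₁, k₂, k₃, k₄, k₅, k₆⟩ := h (H ∩ 𝒮)
  have safe_le (X Y : Set V) :
      (edgesBetween ends (H ∩ 𝒮) X Y).ncard ≤ (edgesBetween ends H X Y).ncard :=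
    Set.ncard_le_ncard fun _ he => ⟨he.1.1, he.2⟩
  have mab := safe_le a b
  have mac := safe_le a c
  have mbd := safe_le b d
  have mcd := safe_le c d
  obtain ⟨r, rfl⟩ := hpeven
  by_cases hIU : r + r + 3 ≤ (cut ends H (A ∩ B)).ncard ∧ r + r + 3 ≤ (cut ends H (A ∪ B)).ncard
  · have eI : (cut ends H (A ∩ B)).ncard = r + r + 3 := by omega
    have eU : (cut ends H (A ∪ B)).ncard = r + r + 3 := by omega
    have sI := gI eI
    have sU := gU eU
    exact Or.inl ⟨⟨hI, hIu, eI, by omega⟩, ⟨hU, hUu, eU, by omega⟩⟩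
  by_cases hD : r + r + 3 ≤ (cut ends H (A \ B)).ncard ∧ r + r + 3 ≤ (cut ends H (B \ A)).ncard
  · have eAB : (cut ends H (A \ B)).ncard = r + r + 3 := by omega
    have eBA : (cut ends H (B \ A)).ncard = r + r + 3 := by omega
    have sAB := gAB eAB
    have sBA := gBA eBA
    exact Or.inr ⟨⟨hAB, hABu, eAB, by omega⟩, ⟨hBA, hBAu, eBA, by omega⟩⟩
  -- Two adjacent regions have at least `p` safe edges but fewer than `p + 3` edges in their cuts,
  -- so more than `p / 2` safe edges but at most `p / 2` edges join them.
  clear gI gU gAB gBA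
  rw [not_and_or, not_le, not_le] at hIU hD
  rcases hIU with hIU | hIU <;> rcases hD with hD | hD <;> omega
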